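/- Let X be a Banach space having Fourier type p for some p ∈ (1,2] with constant c_p, let β > 0, let w ⊂ ℝ be a finite interval, and let σ : ℤ → ℤ be a permutation. Then there is a constant c, depending only on β, p and c_p, such that for every strongly measurable f : w → X with (1/|w|)∫_w ‖f(t)‖_X (log⁺‖f(t)‖_X)^β dt < ∞, Σ_{|k|≥2} (‖f̂_w(σ(k))‖_X / |k|) (log|k|)^{β−1} ≤ c ( 1 + (1/|w|)∫_w ‖f(t)‖_X (log⁺‖f(t)‖_X)^β dt ). -/

import Mathlib

open MeasureTheory Filter Set Topology Real
open scoped ENNReal NNReal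

noncomputable section

universe u
section
variable {X : Type*} [NormedAddCommGroup X] [NormedSpace ℂ X]

/-- Generalized Fourier coefficient on the interval `w = (a,b)`:
`f̂_w(α) = (1/|w|) ∫_w f(t) e^{-2πiαt/|w|} dt`. -/
def intervalFourierCoeff (f : ℝ → X) (a b : ℝ) (α : ℝ) : X :=
  (b - a)⁻¹ • ∫ t in Ioo a b,
    Complex.exp (-(2 * (π : ℂ) * Complex.I * (α : ℂ) * (t : ℂ)) / ((b : ℂ) - (a : ℂ))) • f t

/-- `X` has Fourier type `p` with constant `c`. -/
def HasFourierTypeWith (X : Type*) [NormedAddCommGroup X] [NormedSpace ℂ X]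
    (p c : ℝ) : Prop :=
  ∀ a b : ℝ, a < b → ∀ f : ℝ → X, AEStronglyMeasurable f (volume.restrict (Ioo a b)) →
    (∑' k : ℤ, (‖intervalFourierCoeff f a b k‖₊ : ℝ≥0∞) ^ (p / (p - 1))) ^ ((p - 1) / p)
      ≤ ENNReal.ofReal c *
        ((ENNReal.ofReal (b - a))⁻¹ * ∫⁻ t in Ioo a b, (‖f t‖₊ : ℝ≥0∞) ^ p) ^ (1 / p)

/-- `log⁺ u = max (log u) 0`. -/
def logPlus (u : ℝ) : ℝ := max (Real.log u) 0

/-- The normalized `L (log L)^β` "norm" `(1/|w|) ∫_w ‖f‖ (log⁺‖f‖)^β` on `w = (a,b)`. -/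
def avgLlogL (f : ℝ → X) (β a b : ℝ) : ℝ≥0∞ :=
  (ENNReal.ofReal (b - a))⁻¹ *
    ∫⁻ x in Ioo a b, ENNReal.ofReal (‖f x‖ * logPlus ‖f x‖ ^ β)

/-- Carleson average `C_k(f,w) = γ⁻¹ Σ_μ ‖f̂_w(k+μ/3)‖/(1+μ²)`. -/
def carlesonAvg (f : ℝ → X) (a b : ℝ) (k : ℤ) : ℝ :=
  (∑' μ : ℤ, (1 + (μ : ℝ) ^ 2)⁻¹)⁻¹ *
    ∑' μ : ℤ, ‖intervalFourierCoeff f a b ((k : ℝ) + (μ : ℝ) / 3)‖ / (1 + (μ : ℝ) ^ 2)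
end

/-- The weight `(log |k|)^(β - 1) / |k|` for `|k| ≥ 2`, extended by zero. -/
def logWeight (β : ℝ) (k : ℤ) : ℝ≥0∞ :=
  if 2 ≤ |k| then ENNReal.ofReal (|(k : ℝ)|⁻¹ * Real.log |(k : ℝ)| ^ (β - 1)) else 0

theorem tsum_natAbs_le (g : ℕ → ℝ≥0∞) : ∑' k : ℤ, g k.natAbs ≤ 2 * ∑' n, g n := by
  rw [tsum_of_nat_of_neg_add_one ENNReal.summable ENNReal.summable, two_mul]
  refine add_le_add (by simp) ?_
  have h (n : ℕ) : (-((n : ℤ) + 1)).natAbs = n + 1 := by omega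
  simp_rw [h]
  exact ENNReal.tsum_comp_le_tsum_of_injective (add_left_injective 1) g

theorem min_one_mul_rpow_sub_one_mul_sub_le {β x y : ℝ} (hβ : 0 < β) (hy : 0 ≤ y) (hyx : y ≤ x)
    (hx : 0 < x) : min 1 β * (x ^ (β - 1) * (x - y)) ≤ x ^ β - y ^ β := by
  have hxβ : x ^ β = x ^ (β - 1) * x := by
    rw [← Real.rpow_add_one hx.ne', sub_add_cancel]
  have hxp : 0 < x ^ (β - 1) := Real.rpow_pos_of_pos hx _
  rcases le_total 1 β with h | h
  · rw [min_eq_left h]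
    have : y ^ β ≤ x ^ (β - 1) * y := by
      rcases hy.eq_or_lt with rfl | hy'
      · simp [Real.zero_rpow hβ.ne']
      · rw [show y ^ β = y ^ (β - 1) * y by rw [← Real.rpow_add_one hy'.ne', sub_add_cancel]]
        gcongr
    linarith
  · rw [min_eq_right h]
    have h1 : -1 ≤ y / x - 1 := by
      have : 0 ≤ y / x := by positivity
      linarith
    have h2 := rpow_one_add_le_one_add_mul_self h1 hβ.le h
    rw [show 1 + (y / x - 1) = y / x by ring, Real.div_rpow hy hx.le,
      div_le_iff₀ (Real.rpow_pos_of_pos hx _)] at h2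
    have h3 : (1 + β * (y / x - 1)) * x ^ β = x ^ β + β * (x ^ (β - 1) * (y - x)) := by
      rw [hxβ]
      field_simp
    linarith

theorem sum_range_log_rpow_div_le {β L : ℝ} (hβ : 0 < β) (hL : 0 ≤ L) (N : ℕ) :
    ∑ n ∈ Finset.range (N + 1), (if 2 ≤ n ∧ Real.log n < L then
      (n : ℝ)⁻¹ * Real.log n ^ (β - 1) else 0) ≤ (min 1 β)⁻¹ * min (Real.log N) L ^ β := by
  have hm : 0 < min 1 β := lt_min one_pos hβ
  induction N with
  | zero => simp [hL, Real.zero_rpow hβ.ne']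
  | succ N ih =>
    rw [Finset.sum_range_succ]
    have hlog : Real.log N ≤ Real.log (N + 1 : ℕ) := by
      rcases Nat.eq_zero_or_pos N with rfl | hN
      · simp
      · exact Real.log_le_log (by exact_mod_cast hN) (by push_cast; linarith)
    have h0 : 0 ≤ Real.log N := Real.log_natCast_nonneg N
    split_ifs with h
    · obtain ⟨h2, hlt⟩ := h
      rw [min_eq_left (hlog.trans hlt.le)] at ih
      rw [min_eq_left hlt.le]
      have hN : (0 : ℝ) < N := by
        have : 0 < N := by omega
        exact_mod_cast this
      have hpos : 0 < Real.log (N + 1 : ℕ) :=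
        Real.log_pos (by push_cast; linarith)
      have key := min_one_mul_rpow_sub_one_mul_sub_le hβ h0 hlog hpos
      have hdiff : ((N + 1 : ℕ) : ℝ)⁻¹ ≤ Real.log (N + 1 : ℕ) - Real.log N := by
        rw [← Real.log_div (by positivity) hN.ne']
        refine le_trans (le_of_eq ?_) (Real.one_sub_inv_le_log_of_pos (by positivity))
        push_cast
        field_simp
        ring
      have hterm : ((N + 1 : ℕ) : ℝ)⁻¹ * Real.log (N + 1 : ℕ) ^ (β - 1) ≤
          (min 1 β)⁻¹ * (Real.log (N + 1 : ℕ) ^ β - Real.log N ^ β) := by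
        rw [le_inv_mul_iff₀ hm]
        refine le_trans ?_ key
        rw [mul_comm (((N + 1 : ℕ) : ℝ)⁻¹)]
        gcongr
      linarith
    · rw [add_zero]
      refine ih.trans ?_
      gcongr

theorem tsum_logWeight_lt_le {β L : ℝ} (hβ : 0 < β) (hL : 0 ≤ L) :
    ∑' k : ℤ, (if Real.log |(k : ℝ)| < L then logWeight β k else 0) ≤
      2 * ENNReal.ofReal ((min 1 β)⁻¹ * L ^ β) := by
  let r : ℕ → ℝ := fun n => if 2 ≤ n ∧ Real.log n < L then
      (n : ℝ)⁻¹ * Real.log n ^ (β - 1) else 0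
  have hr (n : ℕ) : 0 ≤ r n := by
    simp only [r]
    split_ifs
    · have := Real.log_natCast_nonneg n
      positivity
    · rfl
  calc _ = ∑' k : ℤ, ENNReal.ofReal (r k.natAbs) := by
        refine tsum_congr fun k => ?_
        have h1 : ((k.natAbs : ℕ) : ℝ) = |(k : ℝ)| := Nat.cast_natAbs k |>.trans (by simp)
        have h2 : 2 ≤ k.natAbs ↔ 2 ≤ |k| := by rw [Int.abs_eq_natAbs]; omega
        simp only [r, logWeight, h1, h2, ← ite_and, and_comm (b := 2 ≤ |k|)]
        split_ifs <;> simp_all only [ENNReal.ofReal_zero]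
    _ ≤ 2 * ∑' n, ENNReal.ofReal (r n) := tsum_natAbs_le fun n => ENNReal.ofReal (r n)
    _ ≤ _ := by
        gcongr
        refine ENNReal.tsum_le_of_sum_range_le fun N => ?_
        rw [← ENNReal.ofReal_sum_of_nonneg fun n _ => hr n]
        refine ENNReal.ofReal_le_ofReal ?_
        calc _ ≤ ∑ n ∈ Finset.range (N + 1), r n :=
              Finset.sum_le_sum_of_subset_of_nonneg
                (Finset.range_mono N.le_succ) fun n _ _ => hr n
          _ ≤ _ := sum_range_log_rpow_div_le hβ hL N
          _ ≤ _ := by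
              have := Real.log_natCast_nonneg N
              have hm : 0 < min 1 β := lt_min one_pos hβ
              gcongr
              exact min_le_right _ _

theorem summable_rpow_neg_mul_log_rpow {a : ℝ} (b : ℝ) (ha : 1 < a) :
    Summable fun n : ℕ => (n : ℝ) ^ (-a) * Real.log n ^ b := by
  have h1 : Summable fun n : ℕ => (n : ℝ) ^ (-((a + 1) / 2)) :=
    Real.summable_nat_rpow.2 (by linarith)
  refine summable_of_isBigO_nat h1 ?_
  have h2 := ((isLittleO_log_rpow_rpow_atTop b (show 0 < (a - 1) / 2 by linarith)).comp_tendsto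
    tendsto_natCast_atTop_atTop).isBigO
  have h3 := (Asymptotics.isBigO_refl (fun n : ℕ => (n : ℝ) ^ (-a)) atTop).mul h2
  refine h3.congr' (.of_forall fun _ => rfl) ?_
  filter_upwards [eventually_gt_atTop 0] with n hn
  have : (0 : ℝ) < n := by exact_mod_cast hn
  simp only [Function.comp_apply]
  rw [← Real.rpow_add this]
  congr 1
  ring

theorem tsum_rpow_mul_logWeight_rpow_ne_top {p : ℝ} (β : ℝ) {r : ℝ} (hp : 0 < p)
    (hr : 1 < p * (1 - r)) :
    ∑' k : ℤ, (ENNReal.ofReal (|(k : ℝ)| ^ r) * logWeight β k) ^ p ≠ ⊤ := by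
  let g : ℕ → ℝ := fun n => (n : ℝ) ^ (-(p * (1 - r))) * Real.log n ^ (p * (β - 1))
  have hg : ∑' n, ENNReal.ofReal (g n) ≠ ⊤ :=
    (summable_rpow_neg_mul_log_rpow (p * (β - 1)) hr).tsum_ofReal_ne_top
  refine ne_top_of_le_ne_top (ENNReal.mul_ne_top ENNReal.ofNat_ne_top hg)
    (le_trans (ENNReal.tsum_le_tsum fun k => ?_) (tsum_natAbs_le fun n => ENNReal.ofReal (g n)))
  have h1 : ((k.natAbs : ℕ) : ℝ) = |(k : ℝ)| := Nat.cast_natAbs k |>.trans (by simp)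
  simp only [logWeight, g, h1]
  split_ifs with hk
  · have hk' : (2 : ℝ) ≤ |(k : ℝ)| := by exact_mod_cast hk
    have hpos : 0 < |(k : ℝ)| := by linarith
    have hlog : 0 < Real.log |(k : ℝ)| := Real.log_pos (by linarith)
    rw [← ENNReal.ofReal_mul (by positivity), ENNReal.ofReal_rpow_of_nonneg (by positivity) hp.le]
    refine ENNReal.ofReal_le_ofReal (le_of_eq ?_)
    rw [← mul_assoc, Real.mul_rpow (by positivity) (by positivity), ← Real.rpow_mul hlog.le,
      ← Real.rpow_neg_one, ← Real.rpow_add hpos, ← Real.rpow_mul hpos.le]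
    ring_nf
  · simp [ENNReal.zero_rpow_of_pos hp]

theorem mul_logWeight_le {β s : ℝ} (hs : 0 < s) (n : ℕ) (k : ℤ) {x A : ℝ≥0∞} (hx : x ≤ A) :
    x * logWeight β k ≤
      ENNReal.ofReal (Real.exp (-(2 * n))) *
        (x * (ENNReal.ofReal (|(k : ℝ)| ^ (2 * s)) * logWeight β k)) +
      (if Real.log |(k : ℝ)| < n / s then logWeight β k else 0) * A := by
  split_ifs with h
  · rw [mul_comm _ A]
    exact le_add_left (by gcongr)
  · rw [zero_mul, add_zero]
    by_cases hk : 2 ≤ |k|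
    · have hk' : (2 : ℝ) ≤ |(k : ℝ)| := by exact_mod_cast hk
      have h1 : 1 ≤ Real.exp (-(2 * n)) * |(k : ℝ)| ^ (2 * s) := by
        rw [Real.rpow_def_of_pos (by linarith), ← Real.exp_add]
        refine Real.one_le_exp ?_
        rw [not_lt, div_le_iff₀ hs] at h
        linarith
      have h2 : 1 ≤ ENNReal.ofReal (Real.exp (-(2 * n))) *
          ENNReal.ofReal (|(k : ℝ)| ^ (2 * s)) := by
        rw [← ENNReal.ofReal_mul (Real.exp_pos _).le]
        simpa using ENNReal.ofReal_le_ofReal h1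
      calc x * logWeight β k = 1 * (x * logWeight β k) := (one_mul _).symm
        _ ≤ ENNReal.ofReal (Real.exp (-(2 * n))) * ENNReal.ofReal (|(k : ℝ)| ^ (2 * s)) *
            (x * logWeight β k) := by gcongr
        _ = _ := by ring
    · simp [logWeight, hk]

section
variable {X : Type*} [NormedAddCommGroup X]

theorem avgLlogL_congr {f g : ℝ → X} {a b : ℝ}
    (h : f =ᵐ[volume.restrict (Ioo a b)] g) (β : ℝ) : avgLlogL f β a b = avgLlogL g β a b := by
  unfold avgLlogL
  congr 1
  refine lintegral_congr_ae ?_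
  filter_upwards [h] with t ht
  rw [ht]

theorem measurableSet_floor_logPlus {f : ℝ → X} (hf : StronglyMeasurable f) (n : ℕ) :
    MeasurableSet {t | ⌊logPlus ‖f t‖⌋₊ = n} :=
  (Nat.measurable_floor.comp ((Real.measurable_log.comp hf.norm.measurable).max
    measurable_const)) (measurableSet_singleton n)

theorem tsum_lintegral_floor_indicator_le {f : ℝ → X} (hf : StronglyMeasurable f) {β : ℝ}
    (hβ : 0 < β) (a b : ℝ) :
    ∑' n : ℕ, ENNReal.ofReal ((n : ℝ) ^ β) * ((ENNReal.ofReal (b - a))⁻¹ *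
      ∫⁻ t in Ioo a b, ‖{t | ⌊logPlus ‖f t‖⌋₊ = n}.indicator f t‖ₑ) ≤ avgLlogL f β a b := by
  have hE (n : ℕ) : MeasurableSet {t | ⌊logPlus ‖f t‖⌋₊ = n} :=
    measurableSet_floor_logPlus hf n
  have hd : Pairwise (Function.onFun Disjoint fun n : ℕ => {t | ⌊logPlus ‖f t‖⌋₊ = n}) :=
    pairwise_disjoint_fiber (fun t => ⌊logPlus ‖f t‖⌋₊)
  have hU : ⋃ n : ℕ, {t | ⌊logPlus ‖f t‖⌋₊ = n} = univ := by ext; simp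
  unfold avgLlogL
  simp_rw [mul_left_comm _ (ENNReal.ofReal (b - a))⁻¹]
  rw [ENNReal.tsum_mul_left]
  gcongr
  have h1 := lintegral_iUnion hE hd
    (fun x => ENNReal.ofReal (‖f x‖ * logPlus ‖f x‖ ^ β)) (μ := volume.restrict (Ioo a b))
  rw [hU, Measure.restrict_univ] at h1
  rw [h1]
  refine ENNReal.tsum_le_tsum fun n => ?_
  rw [← lintegral_const_mul' _ _ ENNReal.ofReal_ne_top, ← lintegral_indicator (hE n)]
  refine lintegral_mono fun t => ?_
  by_cases ht : t ∈ {t | ⌊logPlus ‖f t‖⌋₊ = n}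
  · simp only [indicator_of_mem ht]
    have hnn : 0 ≤ logPlus ‖f t‖ := le_max_right _ _
    have hn : (n : ℝ) ≤ logPlus ‖f t‖ := by
      rw [← show ⌊logPlus ‖f t‖⌋₊ = n from ht]
      exact Nat.floor_le hnn
    rw [← ofReal_norm, ← ENNReal.ofReal_mul (by positivity), mul_comm]
    gcongr
  · simp [indicator_of_notMem ht]

theorem enorm_floor_indicator_le (f : ℝ → X) (n : ℕ) (t : ℝ) :
    ‖{t | ⌊logPlus ‖f t‖⌋₊ = n}.indicator f t‖ₑ ≤ ENNReal.ofReal (Real.exp (n + 1)) := by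
  by_cases ht : t ∈ {t | ⌊logPlus ‖f t‖⌋₊ = n}
  · rw [indicator_of_mem ht, ← ofReal_norm]
    refine ENNReal.ofReal_le_ofReal ((Real.le_exp_log _).trans (Real.exp_le_exp.2 ?_))
    rw [← show ⌊logPlus ‖f t‖⌋₊ = n from ht]
    exact (le_max_left _ _).trans (Nat.lt_floor_add_one (logPlus ‖f t‖)).le
  · simp [indicator_of_notMem ht]

end

section
variable {X : Type*} [NormedAddCommGroup X] [NormedSpace ℂ X]

theorem intervalFourierCoeff_congr {f g : ℝ → X} {a b : ℝ}
    (h : f =ᵐ[volume.restrict (Ioo a b)] g) (α : ℝ) :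
    intervalFourierCoeff f a b α = intervalFourierCoeff g a b α := by
  unfold intervalFourierCoeff
  congr 1
  refine integral_congr_ae ?_
  filter_upwards [h] with t ht
  rw [ht]

theorem norm_fourier_exp (a b α t : ℝ) :
    ‖Complex.exp (-(2 * (π : ℂ) * Complex.I * (α : ℂ) * (t : ℂ)) / ((b : ℂ) - (a : ℂ)))‖ = 1 := by
  rw [show -(2 * (π : ℂ) * Complex.I * (α : ℂ) * (t : ℂ)) / ((b : ℂ) - (a : ℂ)) =
    ((-(2 * π * α * t) / (b - a) : ℝ) : ℂ) * Complex.I by push_cast; ring]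
  exact Complex.norm_exp_ofReal_mul_I _

theorem enorm_inv_sub {a b : ℝ} (hab : a < b) : ‖(b - a)⁻¹‖ₑ = (ENNReal.ofReal (b - a))⁻¹ := by
  rw [enorm_inv (sub_pos.2 hab).ne', Real.enorm_of_nonneg (sub_pos.2 hab).le]

theorem enorm_intervalFourierCoeff_le (f : ℝ → X) {a b : ℝ} (hab : a < b) (α : ℝ) :
    ‖intervalFourierCoeff f a b α‖ₑ ≤
      (ENNReal.ofReal (b - a))⁻¹ * ∫⁻ t in Ioo a b, ‖f t‖ₑ := by
  unfold intervalFourierCoeff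
  rw [enorm_smul, enorm_inv_sub hab]
  gcongr
  refine (enorm_integral_le_lintegral_enorm _).trans (lintegral_mono fun t => ?_)
  rw [enorm_smul, ← ofReal_norm (Complex.exp _), norm_fourier_exp, ENNReal.ofReal_one, one_mul]

theorem enorm_intervalFourierCoeff_le_tsum_indicator (f : ℝ → X) {a b : ℝ}
    (E : ℕ → Set ℝ) (hE : ∀ n, MeasurableSet (E n)) (hd : Pairwise (Function.onFun Disjoint E))
    (hU : ⋃ n, E n = univ) (α : ℝ) :
    ‖intervalFourierCoeff f a b α‖ₑ ≤
      ∑' n, ‖intervalFourierCoeff ((E n).indicator f) a b α‖ₑ := by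
  unfold intervalFourierCoeff
  simp_rw [enorm_smul]
  rw [ENNReal.tsum_mul_left]
  gcongr
  set e : ℝ → ℂ := fun t =>
    Complex.exp (-(2 * (π : ℂ) * Complex.I * (α : ℂ) * (t : ℂ)) / ((b : ℂ) - (a : ℂ)))
  by_cases hi : Integrable (fun t => e t • f t) (volume.restrict (Ioo a b))
  · have h1 := integral_iUnion hE hd (hi.integrableOn (s := ⋃ n, E n))
    rw [hU, Measure.restrict_univ] at h1
    rw [h1]
    refine enorm_tsum_le_tsum_enorm.trans (ENNReal.tsum_le_tsum fun n => le_of_eq ?_)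
    rw [← integral_indicator (hE n)]
    congr 2
    ext t
    exact indicator_smul_apply (E n) e f t
  · rw [integral_undef hi]
    simp

theorem tsum_enorm_intervalFourierCoeff_mul_le {p cp : ℝ} (hp : 1 < p)
    (hX : HasFourierTypeWith X p cp) {a b : ℝ} (hab : a < b) {σ : ℤ → ℤ}
    (hσ : Function.Bijective σ) {f : ℝ → X}
    (hf : AEStronglyMeasurable f (volume.restrict (Ioo a b))) {M : ℝ≥0∞}
    (hM : ∀ t, ‖f t‖ₑ ≤ M) (v : ℤ → ℝ≥0∞) :
    ∑' k : ℤ, ‖intervalFourierCoeff f a b (σ k)‖ₑ * v k ≤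
      ENNReal.ofReal cp * M * (∑' k, v k ^ p) ^ (1 / p) := by
  have hpq : (p / (p - 1)).HolderConjugate p := (Real.HolderConjugate.conjExponent hp).symm
  have hp0 : 0 < p := by linarith
  have hba : ENNReal.ofReal (b - a) ≠ 0 := by simpa using hab
  have h1 := ENNReal.lintegral_mul_le_Lp_mul_Lq (Measure.count : Measure ℤ) hpq
    (f := fun k => ‖intervalFourierCoeff f a b (σ k)‖ₑ) (g := v)
    measurable_from_top.aemeasurable measurable_from_top.aemeasurable
  simp only [lintegral_count, Pi.mul_apply] at h1
  refine h1.trans ?_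
  gcongr
  have h2 := (Equiv.ofBijective σ hσ).tsum_eq
    (fun k : ℤ => ‖intervalFourierCoeff f a b k‖ₑ ^ (p / (p - 1)))
  simp only [Equiv.ofBijective_apply] at h2
  rw [h2, one_div_div]
  refine (hX a b hab f hf).trans ?_
  gcongr
  calc _ ≤ ((ENNReal.ofReal (b - a))⁻¹ * ∫⁻ _ in Ioo a b, M ^ p) ^ (1 / p) := by
        gcongr with t
        exact hM t
    _ = M := by
        rw [setLIntegral_const, Real.volume_Ioo, mul_comm (M ^ p), ← mul_assoc,
          ENNReal.inv_mul_cancel hba ENNReal.ofReal_ne_top, one_mul, ← ENNReal.rpow_mul,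
          mul_one_div_cancel hp0.ne', ENNReal.rpow_one]

theorem tsum_enorm_intervalFourierCoeff_mul_logWeight_le {p cp β s : ℝ} (hp : 1 < p)
    (hβ : 0 < β) (hs : 0 < s) (hX : HasFourierTypeWith X p cp) {a b : ℝ} (hab : a < b)
    {σ : ℤ → ℤ} (hσ : Function.Bijective σ) {f : ℝ → X} (hf : StronglyMeasurable f) :
    ∑' k : ℤ, ‖intervalFourierCoeff f a b (σ k)‖ₑ * logWeight β k ≤
      (∑' n : ℕ, ENNReal.ofReal (Real.exp (1 - n))) * (ENNReal.ofReal cp *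
        (∑' k : ℤ, (ENNReal.ofReal (|(k : ℝ)| ^ (2 * s)) * logWeight β k) ^ p) ^ (1 / p)) +
      2 * ENNReal.ofReal ((min 1 β)⁻¹ * (s ^ β)⁻¹) * avgLlogL f β a b := by
  set E : ℕ → Set ℝ := fun n => {t | ⌊logPlus ‖f t‖⌋₊ = n}
  have hE (n : ℕ) : MeasurableSet (E n) := measurableSet_floor_logPlus hf n
  have hd : Pairwise (Function.onFun Disjoint E) :=
    pairwise_disjoint_fiber (fun t => ⌊logPlus ‖f t‖⌋₊)
  have hU : ⋃ n : ℕ, E n = univ := by ext; simp [E]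
  have hm : 0 < min 1 β := lt_min one_pos hβ
  set A : ℕ → ℝ≥0∞ := fun n =>
    (ENNReal.ofReal (b - a))⁻¹ * ∫⁻ t in Ioo a b, ‖(E n).indicator f t‖ₑ
  set v : ℤ → ℝ≥0∞ := fun k => ENNReal.ofReal (|(k : ℝ)| ^ (2 * s)) * logWeight β k
  let F : ℕ → ℤ → ℝ≥0∞ := fun n k => ‖intervalFourierCoeff ((E n).indicator f) a b (σ k)‖ₑ
  calc _ ≤ ∑' k : ℤ, ∑' n, F n k * logWeight β k := by
        refine ENNReal.tsum_le_tsum fun k => ?_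
        rw [ENNReal.tsum_mul_right]
        gcongr
        exact enorm_intervalFourierCoeff_le_tsum_indicator f E hE hd hU _
    _ ≤ ∑' k : ℤ, ∑' n : ℕ, (ENNReal.ofReal (Real.exp (-(2 * n))) * (F n k * v k) +
          (if Real.log |(k : ℝ)| < n / s then logWeight β k else 0) * A n) := by
        refine ENNReal.tsum_le_tsum fun k => ENNReal.tsum_le_tsum fun n => ?_
        exact mul_logWeight_le hs n k (enorm_intervalFourierCoeff_le _ hab _)
    _ = ∑' n : ℕ, ENNReal.ofReal (Real.exp (-(2 * n))) * ∑' k, F n k * v k +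
          ∑' n : ℕ, (∑' k : ℤ, if Real.log |(k : ℝ)| < n / s then logWeight β k else 0) * A n := by
        rw [ENNReal.tsum_comm, ← ENNReal.tsum_add]
        simp_rw [ENNReal.tsum_add, ENNReal.tsum_mul_left, ENNReal.tsum_mul_right]
    _ ≤ _ := by
        gcongr
        · rw [← ENNReal.tsum_mul_right]
          refine ENNReal.tsum_le_tsum fun n => ?_
          calc _ ≤ ENNReal.ofReal (Real.exp (-(2 * n))) *
                (ENNReal.ofReal cp * ENNReal.ofReal (Real.exp (n + 1)) *
                  (∑' k, v k ^ p) ^ (1 / p)) := by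
                gcongr
                exact tsum_enorm_intervalFourierCoeff_mul_le hp hX hab hσ
                  (hf.indicator (hE n)).aestronglyMeasurable (enorm_floor_indicator_le f n) v
            _ = (ENNReal.ofReal (Real.exp (-(2 * n))) * ENNReal.ofReal (Real.exp (n + 1))) *
                (ENNReal.ofReal cp * (∑' k, v k ^ p) ^ (1 / p)) := by ring
            _ = _ := by
                rw [← ENNReal.ofReal_mul (Real.exp_pos _).le, ← Real.exp_add,
                  show -(2 * (n : ℝ)) + (n + 1) = 1 - n by ring]
        · refine le_trans ?_
            (mul_le_mul_right (tsum_lintegral_floor_indicator_le hf hβ a b) _)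
          rw [← ENNReal.tsum_mul_left]
          refine ENNReal.tsum_le_tsum fun n => ?_
          rw [← mul_assoc (2 * _)]
          refine mul_le_mul_left
            ((tsum_logWeight_lt_le (L := n / s) hβ (by positivity)).trans ?_) (A n)
          rw [mul_assoc, ← ENNReal.ofReal_mul (by positivity), Real.div_rpow (by positivity) hs.le]
          refine (congrArg (fun y => 2 * ENNReal.ofReal y) ?_).le
          ring

end

open Classical in
/-- Lemma 2.3: if `X` has Fourier type `p ∈ (1,2]` with constant `c_p` and
`β > 0`, then for any finite interval `w`, any permutation `σ` of `ℤ` and any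
`f ∈ L(log L)^β(w; X)`,
`Σ_{|k|≥2} (‖f̂_w(σ(k))‖/|k|)(log|k|)^{β-1} ≤ c (1 + (1/|w|)∫_w ‖f‖(log⁺‖f‖)^β)`,
with `c` depending only on `β, p, c_p`. -/
theorem statement10 (p cp β : ℝ) (hp1 : 1 < p) (hp2 : p ≤ 2) (hcp : 0 < cp) (hβ : 0 < β) :
    ∃ c : ℝ, 0 < c ∧
      ∀ (X : Type u) [NormedAddCommGroup X] [NormedSpace ℂ X] [CompleteSpace X],
        HasFourierTypeWith X p cp →
        ∀ w₁ w₂ : ℝ, w₁ < w₂ → ∀ σ : ℤ → ℤ, Function.Bijective σ →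
        ∀ f : ℝ → X, AEStronglyMeasurable f (volume.restrict (Ioo w₁ w₂)) →
          avgLlogL f β w₁ w₂ < ⊤ →
          (∑' k : ℤ, if 2 ≤ |k| then
              ENNReal.ofReal (‖intervalFourierCoeff f w₁ w₂ (σ k)‖ / |(k : ℝ)| *
                Real.log |(k : ℝ)| ^ (β - 1))
            else 0) ≤
            ENNReal.ofReal c * (1 + avgLlogL f β w₁ w₂) := by
  have hp0 : 0 < p := by linarith
  set s : ℝ := (1 - 1 / p) / 4
  have hs : 0 < s := by
    have : 1 / p < 1 := (div_lt_one hp0).2 hp1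
    simp only [s]
    linarith
  have hr : 1 < p * (1 - 2 * s) := by
    have : p * (1 - 2 * s) = (p + 1) / 2 := by
      simp only [s]
      field_simp
      ring
    linarith
  set B : ℝ≥0∞ := (∑' n : ℕ, ENNReal.ofReal (Real.exp (1 - n))) * (ENNReal.ofReal cp *
    (∑' k : ℤ, (ENNReal.ofReal (|(k : ℝ)| ^ (2 * s)) * logWeight β k) ^ p) ^ (1 / p))
  set D : ℝ≥0∞ := 2 * ENNReal.ofReal ((min 1 β)⁻¹ * (s ^ β)⁻¹)
  have hB : B ≠ ⊤ := by
    refine ENNReal.mul_ne_top ?_ (ENNReal.mul_ne_top ENNReal.ofReal_ne_top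
      (ENNReal.rpow_ne_top_of_nonneg (by positivity)
        (tsum_rpow_mul_logWeight_rpow_ne_top β hp0 hr)))
    have hsum : Summable fun n : ℕ => Real.exp (1 - n) := by
      simp_rw [sub_eq_add_neg, Real.exp_add]
      exact Real.summable_exp_neg_nat.mul_left _
    exact hsum.tsum_ofReal_ne_top
  have hD : D ≠ ⊤ := ENNReal.mul_ne_top ENNReal.ofNat_ne_top ENNReal.ofReal_ne_top
  refine ⟨(B + D).toReal + 1, by positivity, ?_⟩
  intro X _ _ _ hX w₁ w₂ hw σ hσ f hf _
  have hle : B + D ≤ ENNReal.ofReal ((B + D).toReal + 1) :=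
    (ENNReal.ofReal_toReal (ENNReal.add_ne_top.2 ⟨hB, hD⟩)).symm.le.trans
      (ENNReal.ofReal_le_ofReal (by linarith))
  rw [avgLlogL_congr hf.ae_eq_mk]
  calc _ = ∑' k : ℤ, ‖intervalFourierCoeff (hf.mk f) w₁ w₂ (σ k)‖ₑ * logWeight β k := by
        refine tsum_congr fun k => ?_
        rw [intervalFourierCoeff_congr hf.ae_eq_mk, logWeight]
        split_ifs
        · rw [← ofReal_norm, ← ENNReal.ofReal_mul (norm_nonneg _), div_eq_mul_inv, mul_assoc]
        · rw [mul_zero]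
    _ ≤ B + D * avgLlogL (hf.mk f) β w₁ w₂ :=
        tsum_enorm_intervalFourierCoeff_mul_logWeight_le hp1 hβ hs hX hw hσ
          hf.stronglyMeasurable_mk
    _ ≤ (B + D) * (1 + avgLlogL (hf.mk f) β w₁ w₂) := by
        rw [mul_add, mul_one]
        gcongr
        · exact le_self_add
        · exact le_add_self
    _ ≤ _ := by gcongr

end
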